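/- Let α > 0 and define α̂ = 1 if 0 < α ≤ 1, α̂ = 2α if 1 < α < 2, and α̂ = α if α ≥ 2. Then p_n(α) > 0 for every n ≥ 0 and p_{n+1}(α)/p_n(α) ≤ α̂ for every n ≥ 0. Consequently, for s > 0 the terms p_{n+1}(α) s^n/n! of the series e^{−α} φ_α(s) = Σ_{n=0}^{∞} (−1)^n p_{n+1}(α) s^n/n! are nonincreasing in absolute value for n ≥ α̂ s. -/

import Mathlib

open MeasureTheory Filter Set Asymptotics

/-- The sequence of polynomials `p_n(α)` defined by `p_0(α) = 1` and
`p_{n+1}(α) = (α/(n+1)) · Σ_{k=0}^{n} ((k+1)/(k+2)) p_{n−k}(α)`. -/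
noncomputable def bmpP {K : Type*} [Field K] (α : K) : ℕ → K
  | 0 => 1
  | n + 1 => (α / (n + 1)) * ∑ k ∈ Finset.range (n + 1), ((k + 1 : K) / (k + 2)) * bmpP α (n - k)
  decreasing_by exact Nat.lt_succ_of_le (Nat.sub_le n k)

theorem bmpP_succ (α : ℝ) (n : ℕ) :
    ((n : ℝ) + 1) * bmpP α (n + 1) =
      α * ∑ k ∈ Finset.range (n + 1), ((k + 1 : ℝ) / (k + 2)) * bmpP α (n - k) := by
  have h : (n : ℝ) + 1 ≠ 0 := by positivity
  rw [bmpP]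
  field_simp

theorem bmpP_pos {α : ℝ} (hα : 0 < α) (n : ℕ) : 0 < bmpP α n := by
  induction n using Nat.strong_induction_on with
  | _ n ih =>
    cases n with
    | zero => simp [bmpP]
    | succ n =>
      rw [bmpP]
      refine mul_pos (by positivity) (Finset.sum_pos (fun k _ => ?_) ⟨0, by simp⟩)
      exact mul_pos (by positivity) (ih _ (by omega))

/-- A bound on the ratio of successive terms coming from `c (k + 1) ≤ 4 / 3 * c k` for
the weights `c k = (k + 1) / (k + 2)`. -/
theorem bmpP_succ_le {α : ℝ} (hα : 0 < α) (n : ℕ) :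
    ((n : ℝ) + 1) * bmpP α (n + 1) ≤ (4 / 3 * n + α / 2) * bmpP α n := by
  cases n with
  | zero => simp [bmpP, div_eq_mul_inv]
  | succ n =>
    have h1 := bmpP_succ α (n + 1)
    have h2 := bmpP_succ α n
    rw [Finset.sum_range_succ'] at h1
    simp only [Nat.add_sub_add_right, Nat.sub_zero] at h1
    have h3 : ∑ k ∈ Finset.range (n + 1), (((k + 1 : ℕ) + 1 : ℝ) / ((k + 1 : ℕ) + 2)) *
          bmpP α (n - k) ≤
        4 / 3 * ∑ k ∈ Finset.range (n + 1), ((k + 1 : ℝ) / (k + 2)) * bmpP α (n - k) := by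
      rw [Finset.mul_sum]
      refine Finset.sum_le_sum fun k _ => ?_
      rw [← mul_assoc]
      refine mul_le_mul_of_nonneg_right ?_ (bmpP_pos hα _).le
      push_cast
      rw [← mul_div_assoc, div_le_div_iff₀ (by positivity) (by positivity)]
      nlinarith [(Nat.cast_nonneg k : (0 : ℝ) ≤ k), sq_nonneg (k : ℝ)]
    have h4 := mul_le_mul_of_nonneg_left h3 hα.le
    push_cast at *
    linarith

/-- A Kaluza-type criterion: if `s` is positive and log-convex and
`s 0 * s n ≤ (n + 1) * s (n + 1)`, then the power series
`exp (-∑ s k x ^ (k + 1) / (k + 1))` is `1` minus a series with nonnegative coefficients;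
`T n` is the coefficient of `x ^ (n + 1)` in that series. -/
theorem nonneg_of_log_convex_recurrence {s T : ℕ → ℝ} (hs : ∀ n, 0 < s n)
    (hconv : ∀ k n, k ≤ n → s (k + 1) * s n ≤ s k * s (n + 1))
    (hzero : ∀ n : ℕ, s 0 * s n ≤ (n + 1) * s (n + 1))
    (hT : ∀ n : ℕ, ((n : ℝ) + 1) * T n = s n - ∑ k ∈ Finset.range n, s k * T (n - 1 - k))
    (n : ℕ) : 0 ≤ T n := by
  induction n using Nat.strong_induction_on with
  | _ n ih =>
    cases n with
    | zero =>
      have h := hT 0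
      simp only [Nat.cast_zero, zero_add, one_mul, Finset.range_zero, Finset.sum_empty,
        sub_zero] at h
      exact h ▸ (hs 0).le
    | succ n =>
      have h1 := hT (n + 1)
      have h0 := hT n
      rw [Finset.sum_range_succ'] at h1
      have hidx : ∀ k, n + 1 - 1 - (k + 1) = n - 1 - k := fun k => by omega
      simp only [hidx] at h1
      simp only [Nat.add_sub_cancel, Nat.sub_zero] at h1
      have hsum : s n * ∑ k ∈ Finset.range n, s (k + 1) * T (n - 1 - k) ≤
          s (n + 1) * ∑ k ∈ Finset.range n, s k * T (n - 1 - k) := by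
        rw [Finset.mul_sum, Finset.mul_sum]
        refine Finset.sum_le_sum fun k hk => ?_
        have hk := Finset.mem_range.1 hk
        linarith [mul_le_mul_of_nonneg_right (hconv k n hk.le) (ih (n - 1 - k) (by omega))]
      have hn := mul_le_mul_of_nonneg_right (hzero n) (ih n (by omega))
      have key : 0 ≤ s n * (((n + 1 : ℕ) + 1 : ℝ) * T (n + 1)) := by
        rw [h1]
        linear_combination hn + hsum + s (n + 1) * h0
      have := nonneg_of_mul_nonneg_right key (hs n)
      exact nonneg_of_mul_nonneg_right this (by positivity)

theorem bmpP_succ_le_self {α : ℝ} (hα : 0 < α) (hα1 : α ≤ 1) (n : ℕ) :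
    bmpP α (n + 1) ≤ bmpP α n := by
  have hs : ∀ k : ℕ, 1 - α * ((k + 1 : ℝ) / (k + 2)) = (1 - α) + α * (1 / (k + 2)) := by
    intro k
    field_simp
    ring
  suffices h : 0 ≤ bmpP α n - bmpP α (n + 1) by linarith
  refine nonneg_of_log_convex_recurrence (s := fun k : ℕ => 1 - α * ((k + 1 : ℝ) / (k + 2)))
    (T := fun n => bmpP α n - bmpP α (n + 1)) ?_ ?_ ?_ ?_ n
  · intro k
    have : 0 < α * (1 / ((k : ℝ) + 2)) := by positivity
    simp only [hs]
    linarith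
  · intro k n hkn
    have hkn' : (k : ℝ) ≤ n := by exact_mod_cast hkn
    simp only [hs]
    push_cast
    have e1 : 1 / ((n : ℝ) + 2) - 1 / (n + 1 + 2) ≤ 1 / (k + 2) - 1 / (k + 1 + 2) := by
      have e : ∀ x : ℕ, 1 / ((x : ℝ) + 2) - 1 / (x + 1 + 2) = 1 / ((x + 2) * (x + 1 + 2)) := by
        intro x
        field_simp
        ring
      rw [e, e]
      gcongr
    have e2 : 1 / ((k : ℝ) + 1 + 2) * (1 / (n + 2)) ≤ 1 / (k + 2) * (1 / (n + 1 + 2)) := by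
      rw [one_div_mul_one_div, one_div_mul_one_div]
      apply one_div_le_one_div_of_le (by positivity)
      nlinarith
    have h1 := mul_le_mul_of_nonneg_left e1 (mul_nonneg (sub_nonneg.2 hα1) hα.le)
    have h2 := mul_le_mul_of_nonneg_left e2 (sq_nonneg α)
    linear_combination h1 + h2
  · intro n
    cases n with
    | zero =>
      norm_num
      nlinarith
    | succ n =>
      have h0 : 1 - α * (((0 : ℕ) + 1 : ℝ) / ((0 : ℕ) + 2)) ≤ 1 := by
        norm_num
        positivity
      simp only [hs] at *
      push_cast at *
      have hu : 0 ≤ 1 - α + α * (1 / ((n : ℝ) + 1 + 2)) := by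
        have : 0 ≤ α * (1 / ((n : ℝ) + 1 + 2)) := by positivity
        linarith
      have hv : 0 ≤ 1 - α + α * (1 / ((n : ℝ) + 1 + 1 + 2)) := by
        have : 0 ≤ α * (1 / ((n : ℝ) + 1 + 1 + 2)) := by positivity
        linarith
      have huv : 1 / ((n : ℝ) + 1 + 2) ≤ 2 * (1 / ((n : ℝ) + 1 + 1 + 2)) := by
        rw [mul_one_div, div_le_div_iff₀ (by positivity) (by positivity)]
        linarith [(Nat.cast_nonneg n : (0 : ℝ) ≤ n)]
      have h1 := mul_le_mul_of_nonneg_right h0 hu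
      have h2 := mul_le_mul_of_nonneg_left huv hα.le
      have h3 := mul_nonneg (Nat.cast_nonneg n : (0 : ℝ) ≤ n) hv
      linarith
  · intro n
    have h1 := bmpP_succ α n
    rw [Finset.sum_range_succ] at h1
    have htel : ∑ k ∈ Finset.range n, (bmpP α (n - 1 - k) - bmpP α (n - 1 - k + 1)) =
        1 - bmpP α n := by
      rw [Finset.sum_range_reflect (fun j => bmpP α j - bmpP α (j + 1)) n,
        Finset.sum_range_sub', bmpP]
    have hc : α * ∑ k ∈ Finset.range n, ((k + 1 : ℝ) / (k + 2)) * bmpP α (n - 1 - k) =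
        n * bmpP α n := by
      cases n with
      | zero => simp
      | succ m => exact_mod_cast (bmpP_succ α m).symm
    have hshift : ∑ k ∈ Finset.range n, ((k + 1 : ℝ) / (k + 2)) * bmpP α (n - 1 - k + 1) =
        ∑ k ∈ Finset.range n, ((k + 1 : ℝ) / (k + 2)) * bmpP α (n - k) := by
      refine Finset.sum_congr rfl fun k hk => ?_
      have := Finset.mem_range.1 hk
      rw [show n - 1 - k + 1 = n - k by omega]
    simp only [sub_mul, one_mul, mul_sub, Finset.sum_sub_distrib, mul_assoc,
      ← Finset.mul_sum] at htel ⊢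
    rw [hshift]
    rw [Nat.sub_self, show bmpP α 0 = 1 by rw [bmpP]] at h1
    linarith

/-- For `α > 0`, with `α̂ = 1` if `α ≤ 1`, `α̂ = 2α` if `1 < α < 2`, `α̂ = α` if `α ≥ 2`:
`p_n(α) > 0`, `p_{n+1}(α)/p_n(α) ≤ α̂`, and the terms `p_{n+1}(α) s^n/n!` are nonincreasing
for `n ≥ α̂ s`. -/
theorem stmt18 (α : ℝ) (hα : 0 < α)
    (ahat : ℝ) (hhat : ahat = if α ≤ 1 then 1 else if α < 2 then 2 * α else α) :
    (∀ n : ℕ, 0 < bmpP α n) ∧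
    (∀ n : ℕ, bmpP α (n + 1) / bmpP α n ≤ ahat) ∧
    (∀ s : ℝ, 0 < s → ∀ n : ℕ, ahat * s ≤ n →
      bmpP α (n + 2) * s ^ (n + 1) / (n + 1).factorial ≤
        bmpP α (n + 1) * s ^ n / n.factorial) := by
  have hratio : ∀ n : ℕ, bmpP α (n + 1) ≤ ahat * bmpP α n := by
    intro n
    have hp := bmpP_pos hα n
    have hle := bmpP_succ_le hα n
    have hn : (0 : ℝ) < n + 1 := by positivity
    split_ifs at hhat with h1 h2
    · rw [hhat, one_mul]
      exact bmpP_succ_le_self hα h1 n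
    all_goals
      subst hhat
      refine le_of_mul_le_mul_left (hle.trans ?_) hn
      rw [← mul_assoc]
      refine mul_le_mul_of_nonneg_right ?_ hp.le
      push Not at *
      nlinarith [(Nat.cast_nonneg n : (0 : ℝ) ≤ n)]
  refine ⟨bmpP_pos hα, fun n => (div_le_iff₀ (bmpP_pos hα n)).2 (hratio n), ?_⟩
  intro s hs n hn
  have hp := bmpP_pos hα (n + 1)
  have h : bmpP α (n + 2) * s ≤ (n + 1) * bmpP α (n + 1) := by
    nlinarith [mul_le_mul_of_nonneg_right (hratio (n + 1)) hs.le,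
      mul_le_mul_of_nonneg_right hn hp.le]
  rw [Nat.factorial_succ, div_le_div_iff₀ (by positivity) (by positivity)]
  push_cast
  have h5 : 0 ≤ s ^ n * (n.factorial : ℝ) := by positivity
  calc bmpP α (n + 2) * s ^ (n + 1) * n.factorial
      = bmpP α (n + 2) * s * (s ^ n * n.factorial) := by ring
    _ ≤ (n + 1) * bmpP α (n + 1) * (s ^ n * n.factorial) := mul_le_mul_of_nonneg_right h h5
    _ = _ := by ring
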